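/- Conditioned on the boundary states being zero, the transition pair (S_{t−1}, S_t) is conditionally independent of the observations outside its segment: for every pair of indices 0 ≤ a < b ≤ L, every t with a < t ≤ b, every pair of states m′, m ∈ S, and every observation sequence y such that P(Y = y, S_a = 0, S_b = 0) > 0, one has P(S_{t−1} = m′, S_t = m | Y = y, S_a = 0, S_b = 0) = P(S_{t−1} = m′, S_t = m | Y_{(a,b]} = y|_{(a,b]}, S_a = 0, S_b = 0), where {Y_{(a,b]} = y|_{(a,b]}} is the event that the observations with indices a < k ≤ b agree with y. -/

import Mathlib

/-!
Finite hidden Markov source over a memoryless channel.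
States `S` (with distinguished state `0`), channel output symbols `O`.
A state path is `s : Fin (L+1) → S`; an observation sequence is `y : Fin L → O`,
where index `t : Fin L` represents time `t+1 ∈ {1,…,L}`.
-/

open scoped Classical in
/-- The probability of an event `A` under the mass function `P`. -/
noncomputable def prob {S O : Type*} [Fintype S] [Fintype O] {L : ℕ}
    (P : (Fin (L + 1) → S) × (Fin L → O) → ℝ)
    (A : (Fin (L + 1) → S) × (Fin L → O) → Prop) : ℝ :=
  ∑ sy : (Fin (L + 1) → S) × (Fin L → O), if A sy then P sy else 0

/-- The conditional probability `P(A | B)`. -/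
noncomputable def condProb {S O : Type*} [Fintype S] [Fintype O] {L : ℕ}
    (P : (Fin (L + 1) → S) × (Fin L → O) → ℝ)
    (A B : (Fin (L + 1) → S) × (Fin L → O) → Prop) : ℝ :=
  prob P (fun sy => A sy ∧ B sy) / prob P B

open scoped Classical in
theorem prob_mul_prob {S O : Type*} [Fintype S] [Fintype O] {L : ℕ}
    (P : (Fin (L + 1) → S) × (Fin L → O) → ℝ)
    (A B : (Fin (L + 1) → S) × (Fin L → O) → Prop) :
    prob P A * prob P B =
      ∑ x : ((Fin (L + 1) → S) × (Fin L → O)) × ((Fin (L + 1) → S) × (Fin L → O)),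
        if A x.1 ∧ B x.2 then P x.1 * P x.2 else 0 := by
  rw [prob, prob, Finset.sum_mul_sum, ← Fintype.sum_prod_type']
  refine Fintype.sum_congr _ _ fun x => ?_
  by_cases hA : A x.1 <;> by_cases hB : B x.2 <;> simp [hA, hB]

theorem prob_mul_prob_eq_of_involutive {S O : Type*} [Fintype S] [Fintype O] {L : ℕ}
    (P : (Fin (L + 1) → S) × (Fin L → O) → ℝ)
    (A B C D : (Fin (L + 1) → S) × (Fin L → O) → Prop)
    (σ : ((Fin (L + 1) → S) × (Fin L → O)) × ((Fin (L + 1) → S) × (Fin L → O)) →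
      ((Fin (L + 1) → S) × (Fin L → O)) × ((Fin (L + 1) → S) × (Fin L → O)))
    (hσ : Function.Involutive σ)
    (hiff : ∀ x, (A x.1 ∧ B x.2) ↔ (C (σ x).1 ∧ D (σ x).2))
    (hP : ∀ x, A x.1 → B x.2 → P (σ x).1 * P (σ x).2 = P x.1 * P x.2) :
    prob P A * prob P B = prob P C * prob P D := by
  classical
  rw [prob_mul_prob, prob_mul_prob]
  refine Fintype.sum_equiv hσ.toPerm _ _ fun x => ?_
  rw [Function.Involutive.coe_toPerm]
  by_cases h : A x.1 ∧ B x.2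
  · rw [if_pos h, if_pos ((hiff x).1 h), hP x h.1 h.2]
  · rw [if_neg h, if_neg (mt (hiff x).2 h)]

theorem prob_mono {S O : Type*} [Fintype S] [Fintype O] {L : ℕ}
    {P : (Fin (L + 1) → S) × (Fin L → O) → ℝ} (hP : ∀ x, 0 ≤ P x)
    {A B : (Fin (L + 1) → S) × (Fin L → O) → Prop} (h : ∀ x, A x → B x) :
    prob P A ≤ prob P B := by
  classical
  unfold prob
  refine Finset.sum_le_sum fun x _ => ?_
  by_cases hA : A x
  · rw [if_pos hA, if_pos (h x hA)]
  · rw [if_neg hA]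
    split_ifs
    exacts [hP x, le_rfl]

/-- The path and observations that follow `x` on the segment from `a` to `b` and `w` elsewhere. -/
def splice {S O : Type*} {L : ℕ} (a b : Fin (L + 1))
    (x w : (Fin (L + 1) → S) × (Fin L → O)) : (Fin (L + 1) → S) × (Fin L → O) :=
  (fun i => if a ≤ i ∧ i ≤ b then x.1 i else w.1 i,
    fun k => if (a : ℕ) < (k : ℕ) + 1 ∧ (k : ℕ) + 1 ≤ (b : ℕ) then x.2 k else w.2 k)

theorem splice_splice {S O : Type*} {L : ℕ} (a b : Fin (L + 1))
    (x w : (Fin (L + 1) → S) × (Fin L → O)) :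
    splice a b (splice a b x w) (splice a b w x) = x := by
  refine Prod.ext ?_ ?_
  · funext i
    by_cases h : a ≤ i ∧ i ≤ b <;> simp [splice, h]
  · funext k
    by_cases h : (a : ℕ) < (k : ℕ) + 1 ∧ (k : ℕ) + 1 ≤ (b : ℕ) <;>
      simp only [splice, h, and_self, if_true, if_false]

/-- Two trajectories that agree at both ends of a segment can exchange it without changing
the product of their weights. -/
theorem markov_weight_splice_mul {S O : Type*} [Zero S] [DecidableEq S] {L : ℕ}
    (f : O → S → S → ℝ) (P : (Fin (L + 1) → S) × (Fin L → O) → ℝ)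
    (hP : ∀ s y, P (s, y) = (if s 0 = 0 then (1 : ℝ) else 0) *
      ∏ t : Fin L, f (y t) (s t.castSucc) (s t.succ))
    (a b : Fin (L + 1)) (x w : (Fin (L + 1) → S) × (Fin L → O))
    (ha : x.1 a = w.1 a) (hb : x.1 b = w.1 b) :
    P (splice a b x w) * P (splice a b w x) = P x * P w := by
  obtain ⟨s, y⟩ := x
  obtain ⟨s', y'⟩ := w
  simp only at ha hb
  simp only [splice, hP]
  rw [mul_mul_mul_comm, mul_mul_mul_comm (if s 0 = 0 then (1 : ℝ) else 0), ← Finset.prod_mul_distrib, ← Finset.prod_mul_distrib]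
  congr 1
  · split_ifs <;> simp
  · refine Finset.prod_congr rfl fun k _ => ?_
    by_cases hk : (a : ℕ) < (k : ℕ) + 1 ∧ (k : ℕ) + 1 ≤ (b : ℕ)
    · have h₁ : a ≤ k.castSucc ∧ k.castSucc ≤ b := by
        simp only [Fin.le_def, Fin.val_castSucc]; omega
      have h₂ : a ≤ k.succ ∧ k.succ ≤ b := by
        simp only [Fin.le_def, Fin.val_succ]; omega
      simp only [if_pos hk, if_pos h₁, if_pos h₂]
    · have outside (i : Fin (L + 1)) (hi : i ≤ a ∨ b ≤ i) (u v : Fin (L + 1) → S)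
          (hua : u a = v a) (hub : u b = v b) :
          (if a ≤ i ∧ i ≤ b then u i else v i) = v i := by
        split_ifs with h
        · rcases hi with hi | hi
          · rwa [le_antisymm hi h.1]
          · rwa [le_antisymm h.2 hi]
        · rfl
      have h₁ : k.castSucc ≤ a ∨ b ≤ k.castSucc := by
        simp only [Fin.le_def, Fin.val_castSucc]; omega
      have h₂ : k.succ ≤ a ∨ b ≤ k.succ := by
        simp only [Fin.le_def, Fin.val_succ]; omega
      simp only [if_neg hk, outside _ h₁ s s' ha hb, outside _ h₂ s s' ha hb,
        outside _ h₁ s' s ha.symm hb.symm, outside _ h₂ s' s ha.symm hb.symm]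
      exact mul_comm _ _

/-- **Conditional independence of a transition from observations outside its segment,
given zero boundary states.**  For `0 ≤ a < b ≤ L`, any time `t` with `a < t ≤ b`
(`t : Fin L` represents time `t+1`), states `m', m`, and any observation sequence `y`
with `P(Y = y, S_a = 0, S_b = 0) > 0`, conditioning on the full observation sequence
or only on the observations in the segment `(a, b]` gives the same a-posteriori
transition probability. -/
theorem transition_cond_indep_outside_segment
    {S O : Type*} [Fintype S] [Fintype O] [Nonempty S] [Nonempty O]
    [Zero S] [DecidableEq S]
    {L : ℕ} (hL : 1 ≤ L)
    -- the factorizing probability mass function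
    (p : S → S → ℝ) (q : O → S → S → ℝ)
    (hp : ∀ a b, 0 ≤ p a b) (hq : ∀ o a b, 0 ≤ q o a b)
    (P : (Fin (L + 1) → S) × (Fin L → O) → ℝ)
    (hP : ∀ s y, P (s, y) =
      (if s 0 = 0 then (1 : ℝ) else 0) *
        ∏ t : Fin L, p (s t.castSucc) (s t.succ) * q (y t) (s t.castSucc) (s t.succ))
    (hsum : ∑ sy : (Fin (L + 1) → S) × (Fin L → O), P sy = 1)
    -- the boundary indices 0 ≤ a < b ≤ L
    (a b : Fin (L + 1)) (hab : a < b)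
    -- the time t with a < t ≤ b and the pair of states
    (t : Fin L) (hta : (a : ℕ) < (t : ℕ) + 1) (htb : (t : ℕ) + 1 ≤ (b : ℕ))
    (m' m : S)
    -- the observation sequence, with positive joint probability
    (y : Fin L → O)
    (hy : 0 < prob P (fun sy => sy.2 = y ∧ sy.1 a = 0 ∧ sy.1 b = 0)) :
    condProb P (fun sy => sy.1 t.castSucc = m' ∧ sy.1 t.succ = m)
        (fun sy => sy.2 = y ∧ sy.1 a = 0 ∧ sy.1 b = 0) =
      condProb P (fun sy => sy.1 t.castSucc = m' ∧ sy.1 t.succ = m)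
        (fun sy =>
          (∀ k : Fin L, (a : ℕ) < (k : ℕ) + 1 → (k : ℕ) + 1 ≤ (b : ℕ) → sy.2 k = y k) ∧
            sy.1 a = 0 ∧ sy.1 b = 0) := by
  have hnonneg : ∀ x, 0 ≤ P x := by
    rintro ⟨s, z⟩
    rw [hP]
    refine mul_nonneg (by split_ifs <;> norm_num) (Finset.prod_nonneg fun k _ => ?_)
    exact mul_nonneg (hp _ _) (hq _ _ _)
  have hseg := hy.trans_le (prob_mono (B := fun sy =>
    (∀ k : Fin L, (a : ℕ) < (k : ℕ) + 1 → (k : ℕ) + 1 ≤ (b : ℕ) → sy.2 k = y k) ∧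
      sy.1 a = 0 ∧ sy.1 b = 0) hnonneg fun x hx => ⟨fun k _ _ => by rw [hx.1], hx.2⟩)
  rw [condProb, condProb, div_eq_div_iff hy.ne' hseg.ne']
  refine prob_mul_prob_eq_of_involutive P _ _ _ _
    (fun x => (splice a b x.1 x.2, splice a b x.2 x.1))
    (fun x => Prod.ext (splice_splice a b x.1 x.2) (splice_splice a b x.2 x.1)) ?_ ?_
  · rintro ⟨⟨s, z⟩, ⟨s', z'⟩⟩
    have h₁ : a ≤ t.castSucc ∧ t.castSucc ≤ b := by
      simp only [Fin.le_def, Fin.val_castSucc]; omega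
    have h₂ : a ≤ t.succ ∧ t.succ ≤ b := by
      simp only [Fin.le_def, Fin.val_succ]; omega
    simp only [splice, if_pos h₁, if_pos h₂, le_refl, hab.le, and_self, if_true, funext_iff]
    constructor
    · rintro ⟨⟨hA, hz, hs⟩, hz', hs'⟩
      refine ⟨⟨hA, fun k hk hk' => ?_, hs⟩, fun k => ?_, hs'⟩
      · rw [if_pos ⟨hk, hk'⟩, hz]
      · split_ifs with hk
        exacts [hz' k hk.1 hk.2, hz k]
    · rintro ⟨⟨hA, hz, hs⟩, hz', hs'⟩
      refine ⟨⟨hA, fun k => ?_, hs⟩, fun k hk hk' => ?_, hs'⟩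
      · by_cases hk : (a : ℕ) < (k : ℕ) + 1 ∧ (k : ℕ) + 1 ≤ (b : ℕ)
        · simpa only [if_pos hk] using hz k hk.1 hk.2
        · simpa only [if_neg hk] using hz' k
      · simpa only [if_pos (And.intro hk hk')] using hz' k
  · rintro x ⟨-, -, hxa, hxb⟩ ⟨-, hwa, hwb⟩
    exact markov_weight_splice_mul (fun o u v => p u v * q o u v) P hP a b x.1 x.2
      (hxa.trans hwa.symm) (hxb.trans hwb.symm)
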